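/- ∫_0^∞ arctan(t)/(e^{πt} − 1) dt = 1/2 − (ln 2)/2. -/

import Mathlib

open Real MeasureTheory Set Filter Topology

lemma integral_exp_neg_mul_mul_cos {b : ℝ} (hb : 0 < b) (u : ℝ) :
    ∫ s in Ioi (0 : ℝ), exp (-b * s) * cos (u * s) = b / (b ^ 2 + u ^ 2) := by
  have hre : (-b + u * Complex.I : ℂ).re < 0 := by simpa
  have h := congrArg Complex.re (integral_exp_mul_complex_Ioi hre 0)
  rw [← RCLike.re_to_complex, ← integral_re (integrableOn_exp_mul_complex_Ioi hre 0)] at h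
  convert h using 1
  · refine integral_congr_ae (ae_of_all _ fun s ↦ ?_)
    simp [Complex.exp_re]
  · simp [Complex.div_re, Complex.normSq_apply]
    ring

lemma integral_exp_neg_mul_mul_sin {b : ℝ} (hb : 0 < b) (u : ℝ) :
    ∫ s in Ioi (0 : ℝ), exp (-b * s) * sin (u * s) = u / (b ^ 2 + u ^ 2) := by
  have hre : (-b + u * Complex.I : ℂ).re < 0 := by simpa
  have h := congrArg Complex.im (integral_exp_mul_complex_Ioi hre 0)
  rw [← RCLike.im_to_complex, ← integral_im (integrableOn_exp_mul_complex_Ioi hre 0)] at h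
  convert h using 1
  · refine integral_congr_ae (ae_of_all _ fun s ↦ ?_)
    simp [Complex.exp_im]
  · simp [Complex.div_im, Complex.normSq_apply]
    ring

lemma integral_exp_neg_mul_sin_div (t : ℝ) :
    ∫ s in Ioi (0 : ℝ), exp (-s) * (sin (t * s) / s) = arctan t := by
  have hint : Integrable (Function.uncurry fun u s : ℝ ↦ exp (-s) * cos (u * s))
      ((volume.restrict (uIoc 0 t)).prod (volume.restrict (Ioi 0))) := by
    have h1 : Integrable (fun _ : ℝ ↦ (1 : ℝ)) (volume.restrict (uIoc 0 t)) :=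
      (intervalIntegrable_iff.mp intervalIntegrable_const)
    have h2 : IntegrableOn (fun s : ℝ ↦ exp (-s)) (Ioi 0) := by
      simpa using integrableOn_exp_mul_Ioi (a := -1) (by norm_num) 0
    refine (h1.mul_prod h2).mono' (by fun_prop) (ae_of_all _ fun p ↦ ?_)
    simp only [Function.uncurry, norm_mul, norm_eq_abs, abs_exp, one_mul]
    exact mul_le_of_le_one_right (exp_pos _).le (abs_cos_le_one _)
  have h := intervalIntegral_integral_swap hint
  have hL : ∀ u : ℝ, ∫ s in Ioi (0 : ℝ), exp (-s) * cos (u * s) = 1 / (1 + u ^ 2) := by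
    intro u
    simpa using integral_exp_neg_mul_mul_cos one_pos u
  simp_rw [hL] at h
  rw [integral_one_div_one_add_sq, arctan_zero, sub_zero] at h
  rw [h]
  refine setIntegral_congr_fun measurableSet_Ioi fun s hs ↦ ?_
  have hs' : s ≠ 0 := (ne_of_gt hs)
  simp only [intervalIntegral.integral_const_mul]
  rw [intervalIntegral.integral_comp_mul_right (fun x ↦ cos x) hs']
  simp [div_eq_inv_mul]

lemma exp_pi_mul_sub_one_pos {t : ℝ} (ht : 0 < t) : 0 < exp (π * t) - 1 := by
  have := add_one_lt_exp (x := π * t) (by positivity)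
  have : 0 < π * t := by positivity
  linarith

lemma div_exp_sub_one_le {t : ℝ} (ht : 0 < t) :
    t / (exp (π * t) - 1) ≤ exp (-(π / 2) * t) / π := by
  have hpos := exp_pi_mul_sub_one_pos ht
  have hs := self_le_sinh_iff.mpr (show 0 ≤ π * t / 2 by positivity)
  rw [sinh_eq] at hs
  have e1 : exp (π * t) = exp (π * t / 2) * exp (π * t / 2) := by rw [← exp_add]; ring_nf
  have e2 : exp (π * t / 2) * exp (-(π * t / 2)) = 1 := by rw [← exp_add]; simp
  have e3 : exp (-(π / 2) * t) = exp (-(π * t / 2)) := by ring_nf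
  rw [e3, div_le_div_iff₀ hpos pi_pos]
  have e4 : exp (-(π * t / 2)) * (exp (π * t) - 1) =
      exp (π * t / 2) - exp (-(π * t / 2)) := by
    rw [e1]; linear_combination exp (π * t / 2) * e2
  rw [e4]; linarith

lemma integrableOn_div_exp_sub_one :
    IntegrableOn (fun t ↦ t / (exp (π * t) - 1)) (Ioi 0) := by
  have h := (integrableOn_exp_mul_Ioi (a := -(π / 2)) (by simp [pi_pos]) 0).div_const π
  refine h.mono' (Measurable.aestronglyMeasurable (by fun_prop))
    ((ae_restrict_iff' measurableSet_Ioi).mpr (ae_of_all _ fun t ht ↦ ?_))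
  have ht : 0 < t := ht
  rw [norm_of_nonneg (div_nonneg ht.le (exp_pi_mul_sub_one_pos ht).le)]
  exact div_exp_sub_one_le ht

lemma abs_sin_mul_div_le {t s : ℝ} (ht : 0 < t) : |sin (t * s) / s| ≤ t := by
  rcases eq_or_ne s 0 with rfl | hs
  · simpa using ht.le
  rw [abs_div, div_le_iff₀ (abs_pos.mpr hs)]
  simpa [abs_mul, abs_of_pos ht] using abs_sin_le_abs (x := t * s)

lemma integrable_exp_neg_mul_sin_div_div_exp_sub_one : Integrable (Function.uncurry fun t s : ℝ ↦
      exp (-s) * (sin (t * s) / s) / (exp (π * t) - 1))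
      ((volume.restrict (Ioi 0)).prod (volume.restrict (Ioi 0))) := by
  have h2 : IntegrableOn (fun s : ℝ ↦ exp (-s)) (Ioi 0) := by
    simpa using integrableOn_exp_mul_Ioi (a := -1) (by norm_num) 0
  have hae : ∀ᵐ p : ℝ × ℝ ∂((volume.restrict (Ioi 0)).prod (volume.restrict (Ioi 0))),
      p ∈ Ioi (0 : ℝ) ×ˢ Ioi (0 : ℝ) := by
    rw [Measure.prod_restrict]
    exact ae_restrict_mem (measurableSet_Ioi.prod measurableSet_Ioi)
  refine (Integrable.mul_prod integrableOn_div_exp_sub_one h2).mono'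
    (Measurable.aestronglyMeasurable (by fun_prop)) ?_
  filter_upwards [hae] with p hp
  have hw := exp_pi_mul_sub_one_pos hp.1
  simp only [Function.uncurry, norm_mul, norm_div, norm_eq_abs, abs_exp, abs_of_pos hw]
  have := abs_sin_mul_div_le (s := p.2) hp.1
  rw [abs_div] at this
  rw [div_mul_eq_mul_div, mul_comm p.1 (exp (-p.2))]
  exact div_le_div_of_nonneg_right (mul_le_mul_of_nonneg_left this (exp_pos _).le) hw.le

lemma hasSum_integral_sin_div_exp_sub_one {s : ℝ} (hs : 0 < s) :
    HasSum (fun n : ℕ ↦ s / (((n + 1) * π) ^ 2 + s ^ 2))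
      (∫ t in Ioi (0 : ℝ), sin (t * s) / (exp (π * t) - 1)) := by
  have hb : ∀ n : ℕ, 0 < (n + 1) * π := fun n ↦ by positivity
  have hint : ∀ n : ℕ, IntegrableOn (fun t ↦ t * exp (-((n + 1) * π) * t)) (Ioi 0) ∧
      ∫ t in Ioi (0 : ℝ), t * exp (-((n + 1) * π) * t) = 1 / ((n + 1) * π) ^ 2 := by
    intro n
    have key := integral_rpow_mul_exp_neg_mul_Ioi two_pos (hb n)
    have e : ∀ t : ℝ, t ^ ((2 : ℝ) - 1) * exp (-((n + 1) * π * t)) =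
        t * exp (-((n + 1) * π) * t) := fun t ↦ by
      rw [show (2 : ℝ) - 1 = 1 by norm_num, rpow_one, neg_mul]
    simp_rw [e, Gamma_two] at key
    refine ⟨.of_integral_ne_zero (by rw [key]; positivity),
      by rw [key, mul_one, rpow_two, div_pow, one_pow]⟩
  have hF : ∀ n : ℕ, ∀ t ∈ Ioi (0 : ℝ), ‖exp (-((n + 1) * π) * t) * sin (s * t)‖ ≤
      s * (t * exp (-((n + 1) * π) * t)) := by
    intro n t ht
    have ht : 0 < t := ht
    have := abs_sin_le_abs (x := s * t)
    rw [abs_of_pos (mul_pos hs ht)] at this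
    simp only [norm_mul, norm_eq_abs, abs_exp]
    nlinarith [exp_pos (-((n + 1) * π) * t)]
  have hFi : ∀ n : ℕ, IntegrableOn (fun t ↦ exp (-((n + 1) * π) * t) * sin (s * t)) (Ioi 0) :=
    fun n ↦ ((hint n).1.const_mul s).mono' (by fun_prop)
      ((ae_restrict_iff' measurableSet_Ioi).mpr (ae_of_all _ (hF n)))
  have hsum : Summable fun n : ℕ ↦
      ∫ t in Ioi (0 : ℝ), ‖exp (-((n + 1) * π) * t) * sin (s * t)‖ := by
    have hS : Summable fun n : ℕ ↦ s / π ^ 2 * (1 / ((n : ℝ) + 1) ^ 2) := by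
      refine Summable.mul_left _ ?_
      exact_mod_cast (summable_nat_add_iff 1).mpr (summable_one_div_nat_pow.mpr one_lt_two)
    refine hS.of_nonneg_of_le (fun n ↦ integral_nonneg fun _ ↦ norm_nonneg _) fun n ↦ ?_
    refine (setIntegral_mono_on (hFi n).norm ((hint n).1.const_mul s) measurableSet_Ioi
      (hF n)).trans_eq ?_
    rw [integral_const_mul, (hint n).2]
    field_simp
  have h := hasSum_integral_of_summable_integral_norm hFi hsum
  simp_rw [integral_exp_neg_mul_mul_sin (hb _)] at h
  suffices hEq : ∫ t in Ioi (0 : ℝ), sin (t * s) / (exp (π * t) - 1) =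
      ∫ t in Ioi (0 : ℝ), ∑' n : ℕ, exp (-((n + 1) * π) * t) * sin (s * t) by rwa [hEq]
  refine setIntegral_congr_fun measurableSet_Ioi fun t ht ↦ ?_
  have ht : 0 < t := ht
  have hlt : exp (-(π * t)) < 1 := by rw [exp_lt_one_iff]; simp; positivity
  have hg := (hasSum_geometric_of_lt_one (exp_pos _).le hlt).mul_left
    (sin (t * s) * exp (-(π * t)))
  have e : ∀ n : ℕ, exp (-((n + 1) * π) * t) * sin (s * t) =
      sin (t * s) * exp (-(π * t)) * exp (-(π * t)) ^ n := fun n ↦ by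
    rw [← exp_nat_mul, mul_assoc, ← exp_add, mul_comm s, mul_comm]; ring_nf
  simp only [e, hg.tsum_eq]
  have h1 := exp_pi_mul_sub_one_pos ht
  rw [exp_neg]
  have := exp_pos (π * t)
  have : 1 - (exp (π * t))⁻¹ ≠ 0 := by
    rw [exp_neg] at hlt; linarith
  field_simp

lemma hasSum_coth {s : ℝ} (hs : 0 < s) :
    HasSum (fun n : ℕ ↦ s / (((n + 1) * π) ^ 2 + s ^ 2))
      (((1 + exp (-2 * s)) / (1 - exp (-2 * s)) - 1 / s) / 2) := by
  set z : ℂ := s / π * Complex.I with hz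
  have hzi : z ∈ Complex.integerComplement := by
    rw [Complex.mem_integerComplement_iff]
    rintro ⟨n, hn⟩
    have := congrArg Complex.im hn
    rw [hz, ← Complex.ofReal_div] at this
    simp at this
    grind [pi_pos]
  have h := ((Summable.hasSum_iff_tendsto_nat (summable_cotTerm hzi)).mpr
    (tendsto_logDeriv_euler_cot_sub hzi)).mul_left (Complex.I / (2 * π))
  have hpi : (π : ℂ) ≠ 0 := by exact_mod_cast pi_ne_zero
  have hsC : (s : ℂ) ≠ 0 := by exact_mod_cast hs.ne'
  have hlt : exp (-2 * s) < 1 := by rw [exp_lt_one_iff]; linarith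
  have hne : (1 - Complex.exp (-2 * s) : ℂ) ≠ 0 := by
    exact_mod_cast (sub_pos.mpr hlt).ne'
  rw [← Complex.hasSum_ofReal]
  have hterm (n : ℕ) : ((s / (((n + 1) * π) ^ 2 + s ^ 2) : ℝ) : ℂ) =
      Complex.I / (2 * π) * cotTerm z n := by
    have hpos : ((n + 1) * π) ^ 2 + s ^ 2 ≠ 0 := by positivity
    have hposC : (((n + 1) * π) ^ 2 + s ^ 2 : ℂ) ≠ 0 := by exact_mod_cast hpos
    have hp : z + (n + 1) ≠ 0 := by
      simpa using Complex.integerComplement_add_ne_zero hzi (n + 1)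
    have hm : z - (n + 1) ≠ 0 := by
      simpa [sub_eq_add_neg] using Complex.integerComplement_add_ne_zero hzi (-(n + 1))
    have hprod : (z + (n + 1)) * (z - (n + 1)) = -(((n + 1) * π) ^ 2 + s ^ 2) / π ^ 2 := by
      rw [hz]
      field_simp
      linear_combination (s : ℂ) ^ 2 * Complex.I_sq
    rw [cotTerm_identity hzi, hprod, hz]
    push_cast
    field_simp
    linear_combination (((n + 1) * π) ^ 2 + s ^ 2 : ℂ)⁻¹ * Complex.I_sq
  have hval : (((1 + exp (-2 * s)) / (1 - exp (-2 * s)) - 1 / s) / 2 : ℝ) =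
      Complex.I / (2 * π) * (π * Complex.cot (π * z) - 1 / z) := by
    have e : 2 * π * Complex.I * z = -2 * s := by
      rw [hz]
      field_simp
      linear_combination Complex.I_sq
    rw [Complex.cot_pi_eq_exp_ratio, e, hz]
    push_cast
    have hI := Complex.I_ne_zero
    field_simp
    ring
  rw [funext hterm, hval]
  exact h

/-- The function `(coth s - 1 / s) / (2 * s)`. -/
noncomputable def laplaceKernel (s : ℝ) : ℝ :=
  ((1 + exp (-2 * s)) / (1 - exp (-2 * s)) - 1 / s) / (2 * s)

lemma integral_sin_div_exp_sub_one {s : ℝ} (hs : 0 < s) :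
    ∫ t in Ioi (0 : ℝ), sin (t * s) / s / (exp (π * t) - 1) = laplaceKernel s := by
  have h := (hasSum_integral_sin_div_exp_sub_one hs).unique (hasSum_coth hs)
  have e : ∀ t : ℝ, sin (t * s) / s / (exp (π * t) - 1) =
      s⁻¹ * (sin (t * s) / (exp (π * t) - 1)) := fun t ↦ by ring
  simp_rw [e]
  rw [integral_const_mul, h, laplaceKernel]
  field_simp

lemma abs_laplaceKernel_le {s : ℝ} (hs : 0 < s) :
    |laplaceKernel s| ≤ ∫ t in Ioi (0 : ℝ), t / (exp (π * t) - 1) := by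
  rw [← integral_sin_div_exp_sub_one hs, ← norm_eq_abs]
  refine norm_integral_le_of_norm_le integrableOn_div_exp_sub_one
    ((ae_restrict_iff' measurableSet_Ioi).mpr (ae_of_all _ fun t ht ↦ ?_))
  have hw := exp_pi_mul_sub_one_pos ht
  rw [norm_div, norm_eq_abs, norm_eq_abs, abs_of_pos hw]
  exact div_le_div_of_nonneg_right (abs_sin_mul_div_le ht) hw.le

lemma measurable_laplaceKernel : Measurable laplaceKernel := by
  unfold laplaceKernel
  fun_prop

lemma norm_exp_mul_laplaceKernel_le (a : ℝ) {s : ℝ} (hs : 0 < s) :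
    ‖exp (-a * s) * laplaceKernel s‖ ≤
      exp (-a * s) * ∫ t in Ioi (0 : ℝ), t / (exp (π * t) - 1) := by
  rw [norm_mul, norm_eq_abs, norm_eq_abs, abs_exp]
  exact mul_le_mul_of_nonneg_left (abs_laplaceKernel_le hs) (exp_pos _).le

lemma integrableOn_exp_mul_laplaceKernel {a : ℝ} (ha : 0 < a) :
    IntegrableOn (fun s ↦ exp (-a * s) * laplaceKernel s) (Ioi 0) := by
  have := measurable_laplaceKernel
  exact ((integrableOn_exp_mul_Ioi (neg_neg_of_pos ha) 0).mul_const _).mono'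
    (Measurable.aestronglyMeasurable (by fun_prop))
    ((ae_restrict_iff' measurableSet_Ioi).mpr
      (ae_of_all _ fun s hs ↦ norm_exp_mul_laplaceKernel_le a hs))

lemma abs_integral_exp_mul_laplaceKernel_le {a : ℝ} (ha : 0 < a) :
    |∫ s in Ioi (0 : ℝ), exp (-a * s) * laplaceKernel s| ≤
      1 / a * ∫ t in Ioi (0 : ℝ), t / (exp (π * t) - 1) := by
  rw [← norm_eq_abs]
  refine (norm_integral_le_of_norm_le
    ((integrableOn_exp_mul_Ioi (neg_neg_of_pos ha) 0).mul_const _)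
    ((ae_restrict_iff' measurableSet_Ioi).mpr
      (ae_of_all _ fun s hs ↦ norm_exp_mul_laplaceKernel_le a hs))).trans_eq ?_
  rw [integral_mul_const, integral_exp_mul_Ioi (neg_neg_of_pos ha)]
  simp

lemma integral_arctan_div_eq_integral_laplaceKernel :
    ∫ t in Ioi (0 : ℝ), arctan t / (exp (π * t) - 1) =
      ∫ s in Ioi (0 : ℝ), exp (-1 * s) * laplaceKernel s := by
  have h := integral_integral_swap integrable_exp_neg_mul_sin_div_div_exp_sub_one
  have hL : ∫ t in Ioi (0 : ℝ), arctan t / (exp (π * t) - 1) = ∫ t in Ioi (0 : ℝ),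
      ∫ s in Ioi (0 : ℝ), exp (-s) * (sin (t * s) / s) / (exp (π * t) - 1) := by
    refine setIntegral_congr_fun measurableSet_Ioi fun t _ ↦ ?_
    simp only [integral_div]
    rw [integral_exp_neg_mul_sin_div t]
  rw [hL, h]
  refine setIntegral_congr_fun measurableSet_Ioi fun s hs ↦ ?_
  simp only [mul_div_assoc (exp (-s)), integral_const_mul]
  rw [integral_sin_div_exp_sub_one hs, neg_one_mul]

lemma integrableOn_exp_neg_mul_sub_div {a b : ℝ} (ha : 0 < a) (hab : a ≤ b) :
    IntegrableOn (fun s ↦ s⁻¹ * (exp (-(a * s)) - exp (-(b * s)))) (Ioi 0) := by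
  refine ((integrableOn_exp_mul_Ioi (neg_neg_of_pos ha) 0).const_mul (b - a)).mono'
    (Measurable.aestronglyMeasurable (by fun_prop))
    ((ae_restrict_iff' measurableSet_Ioi).mpr (ae_of_all _ fun s hs ↦ ?_))
  have hs : 0 < s := hs
  have h1 : exp (-(b * s)) = exp (-a * s) * exp (-((b - a) * s)) := by
    rw [← exp_add]; ring_nf
  have h2 := add_one_le_exp (-((b - a) * s))
  have h3 : exp (-((b - a) * s)) ≤ 1 := exp_le_one_iff.mpr (by nlinarith)
  have h4 := exp_pos (-a * s)
  rw [h1, ← neg_mul, norm_of_nonneg (mul_nonneg (by positivity) (by nlinarith)),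
    inv_mul_le_iff₀ hs]
  nlinarith

lemma integral_exp_neg_mul_sub_div {a b : ℝ} (ha : 0 < a) (hab : a ≤ b) :
    ∫ s in Ioi (0 : ℝ), s⁻¹ * (exp (-(a * s)) - exp (-(b * s))) = log (b / a) := by
  have h := Frullani.integral_Ioi_eq (f := fun x : ℝ ↦ exp (-x)) (L := 1) (R := 0)
    (ContinuousOn.locallyIntegrableOn (by fun_prop) measurableSet_Ioi) ha (ha.trans_le hab)
    ?_ tendsto_exp_neg_atTop_nhds_zero (by simpa using integrableOn_exp_neg_mul_sub_div ha hab)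
  · simpa using h
  · have : Tendsto (fun x : ℝ ↦ exp (-x)) (𝓝 0) (𝓝 (exp (-0))) :=
      Continuous.tendsto (by fun_prop) 0
    simpa using this.mono_left nhdsWithin_le_nhds

lemma integral_laplaceKernel_sub {a : ℝ} (ha : 0 < a) :
    (∫ s in Ioi (0 : ℝ), exp (-a * s) * laplaceKernel s) -
      ∫ s in Ioi (0 : ℝ), exp (-(a + 2) * s) * laplaceKernel s =
      (a + 1) / 2 * log ((a + 2) / a) - 1 := by
  have hi : IntegrableOn (fun s ↦ exp (-a * s) * laplaceKernel s -
      exp (-(a + 2) * s) * laplaceKernel s) (Ioi 0) := (integrableOn_exp_mul_laplaceKernel ha).sub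
    (integrableOn_exp_mul_laplaceKernel (a := a + 2) (by linarith))
  have hf := (integrableOn_exp_neg_mul_sub_div ha (b := a + 2) (by linarith)).const_mul ((a + 1) / 2)
  have hd : ∀ s ∈ Ioi (0 : ℝ), HasDerivAt (Function.update
        (fun s ↦ s⁻¹ * (exp (-(a * s)) - exp (-((a + 2) * s))) / 2) 0 1)
      ((exp (-a * s) * laplaceKernel s - exp (-(a + 2) * s) * laplaceKernel s) -
        (a + 1) / 2 * (s⁻¹ * (exp (-(a * s)) - exp (-((a + 2) * s))))) s := by
    intro s hs
    have hs : 0 < s := hs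
    have h1 : ∀ c : ℝ, HasDerivAt (fun s ↦ exp (-(c * s))) (exp (-(c * s)) * (-(c * 1))) s :=
      fun c ↦ (((hasDerivAt_id s).const_mul c).neg).exp
    have h2 := (((hasDerivAt_inv hs.ne').mul ((h1 a).sub (h1 (a + 2)))).div_const 2)
    have h3 := h2.congr_of_eventuallyEq (f₁ := Function.update
        (fun s ↦ s⁻¹ * (exp (-(a * s)) - exp (-((a + 2) * s))) / 2) 0 1) (by
      filter_upwards [eventually_ne_nhds hs.ne'] with x hx
      simp [Function.update_of_ne hx])
    refine h3.congr_deriv ?_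
    have hlt : exp (-2 * s) < 1 := by rw [exp_lt_one_iff]; linarith
    have hne := (sub_pos.mpr hlt).ne'
    have e : exp (-((a + 2) * s)) = exp (-(a * s)) * exp (-2 * s) := by
      rw [← exp_add]; ring_nf
    simp only [Pi.sub_apply, laplaceKernel, neg_mul a, neg_mul (a + 2), e]
    generalize exp (-2 * s) = E at hne ⊢
    field_simp
    ring
  have h0 : ContinuousWithinAt (Function.update
        (fun s ↦ s⁻¹ * (exp (-(a * s)) - exp (-((a + 2) * s))) / 2) 0 1) (Ici 0) 0 := by
    refine ContinuousAt.continuousWithinAt ?_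
    rw [continuousAt_update_same]
    have h1 : ∀ c : ℝ, HasDerivAt (fun s ↦ exp (-(c * s))) (exp (-(c * 0)) * (-(c * 1))) 0 :=
      fun c ↦ (((hasDerivAt_id (0 : ℝ)).const_mul c).neg).exp
    have h2 := (((h1 a).sub (h1 (a + 2))).div_const 2).tendsto_slope_zero
    convert h2 using 2
    · simp
      ring
    · simp
  have hT : Tendsto (Function.update
        (fun s ↦ s⁻¹ * (exp (-(a * s)) - exp (-((a + 2) * s))) / 2) 0 1) atTop (𝓝 0) := by
    have h1 : ∀ c : ℝ, 0 < c → Tendsto (fun s : ℝ ↦ exp (-(c * s))) atTop (𝓝 0) := fun c hc ↦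
      tendsto_exp_neg_atTop_nhds_zero.comp (tendsto_id.const_mul_atTop hc)
    have h2 := (tendsto_inv_atTop_zero.mul ((h1 a ha).sub (h1 (a + 2) (by linarith)))).div_const 2
    simp only [sub_zero, mul_zero, zero_div] at h2
    refine h2.congr' ?_
    filter_upwards [eventually_ne_atTop 0] with x hx
    simp [Function.update_of_ne hx]
  have key := integral_Ioi_of_hasDerivAt_of_tendsto h0 hd (hi.sub hf) hT
  rw [integral_sub hi hf, integral_sub (integrableOn_exp_mul_laplaceKernel ha)
    (integrableOn_exp_mul_laplaceKernel (by linarith)), integral_const_mul,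
    integral_exp_neg_mul_sub_div ha (by linarith), Function.update_self] at key
  linarith

lemma integral_laplaceKernel_sub_nat (n : ℕ) :
    (∫ s in Ioi (0 : ℝ), exp (-1 * s) * laplaceKernel s) -
      ∫ s in Ioi (0 : ℝ), exp (-(2 * n + 1) * s) * laplaceKernel s =
      n * log (2 * n + 1) - n + n * log 2 + log n.factorial - log (2 * n).factorial := by
  induction n with
  | zero => simp
  | succ n ih =>
    have h := integral_laplaceKernel_sub (a := 2 * n + 1) (by positivity)
    rw [log_div (by positivity) (by positivity)] at h
    have e1 : log (n + 1).factorial = log (n + 1) + log n.factorial := by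
      rw [Nat.factorial_succ, Nat.cast_mul, log_mul (by positivity) (by positivity)]
      push_cast; rfl
    have e2 : log (2 * (n + 1)).factorial =
        log 2 + log (n + 1) + log (2 * n + 1) + log (2 * n).factorial := by
      have e : ((2 * (n + 1)).factorial : ℝ) = 2 * (n + 1) * (2 * n + 1) * (2 * n).factorial := by
        rw [show 2 * (n + 1) = 2 * n + 1 + 1 by ring, Nat.factorial_succ, Nat.factorial_succ]
        push_cast
        ring
      rw [e, log_mul (by positivity) (by positivity), log_mul (by positivity) (by positivity),
        log_mul (by positivity) (by positivity)]
    rw [e1, e2]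
    push_cast
    have e3 : (2 * ((n : ℝ) + 1) + 1) = 2 * n + 1 + 2 := by ring
    rw [e3]
    linear_combination ih + h

/-- A consequence of Stirling's formula. -/
lemma tendsto_log_factorial_combination :
    Tendsto (fun n : ℕ ↦ n * log (2 * n + 1) - n + n * log 2 + log n.factorial
      - log (2 * n).factorial) atTop (𝓝 (1 / 2 - log 2 / 2)) := by
  have hs : Tendsto (fun n ↦ log (Stirling.stirlingSeq n)) atTop (𝓝 (log √π)) :=
    Stirling.tendsto_stirlingSeq_sqrt_pi.log (by positivity)
  have hs2 := hs.comp
    (tendsto_id.const_mul_atTop' two_pos : Tendsto (fun n : ℕ ↦ 2 * n) atTop atTop)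
  have hl := ((tendsto_mul_log_one_add_div_atTop (1 / 2)).comp tendsto_natCast_atTop_atTop)
  have h := ((hl.add hs).sub hs2).sub_const (log 2 / 2)
  rw [add_sub_cancel_right] at h
  refine h.congr' ?_
  filter_upwards [eventually_gt_atTop 0] with n hn
  have hn : (0 : ℝ) < n := by exact_mod_cast hn
  simp only [Function.comp, Stirling.log_stirlingSeq_formula]
  push_cast
  rw [show (1 : ℝ) + 1 / 2 / n = (2 * n + 1) / (2 * n) by field_simp,
    log_div (by positivity) (by positivity), log_div (by positivity) (by positivity),
    log_div (by positivity) (by positivity), log_mul (by positivity) (by positivity),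
    log_mul (by positivity) (by positivity), log_mul (by positivity) (by positivity), log_exp]
  ring

theorem integral_T0_half :
    ∫ t in Set.Ioi (0 : ℝ), Real.arctan t / (Real.exp (π * t) - 1) =
      1 / 2 - Real.log 2 / 2 := by
  rw [integral_arctan_div_eq_integral_laplaceKernel]
  have h0 : Tendsto (fun n : ℕ ↦
      ∫ s in Ioi (0 : ℝ), exp (-(2 * n + 1) * s) * laplaceKernel s) atTop (𝓝 0) := by
    have ht : Tendsto (fun n : ℕ ↦ 1 / (2 * n + 1 : ℝ) *
        ∫ t in Ioi (0 : ℝ), t / (exp (π * t) - 1)) atTop (𝓝 (0 *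
        ∫ t in Ioi (0 : ℝ), t / (exp (π * t) - 1))) := by
      refine Tendsto.mul_const _ ?_
      simp only [one_div]
      exact tendsto_inv_atTop_zero.comp (tendsto_atTop_add_const_right _ _
        (tendsto_natCast_atTop_atTop.const_mul_atTop two_pos))
    rw [zero_mul] at ht
    exact squeeze_zero_norm (fun n ↦ abs_integral_exp_mul_laplaceKernel_le (by positivity)) ht
  have h := tendsto_const_nhds (x := ∫ s in Ioi (0 : ℝ), exp (-1 * s) * laplaceKernel s)
    (f := atTop (α := ℕ)) |>.sub h0
  simp only [integral_laplaceKernel_sub_nat, sub_zero] at h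
  exact tendsto_nhds_unique h tendsto_log_factorial_combination
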